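/- For every real M ≥ 1 there exists a constant C_M, depending only on M, with the following property. Let μ be a symmetric discrete probability measure on a group G, let HP be a coset nilprogression in G of rank and nilpotency class at most M which is in M-normal form, let X be a finite non-empty subset of G with |X| ≤ M, let n ≥ 1 be a natural number, and suppose that ∑_{g ∈ G} ‖g‖_{HP,X}²·μ(g) ≤ M/n. Then ‖μ^{*n}‖_{ℓ²(G)}^{−2} ≤ C_M·|HP|. -/

import Mathlib

open scoped Pointwise ENNReal

universe u

/-- The nilprogression `P(v₁,…,v_r; N₁,…,N_r)`: the set of all evaluations in `G` of words in
the letters `v i, (v i)⁻¹` in which, for each `i`, the total number of occurrences of `v i`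
and `(v i)⁻¹` is at most `N i`. -/
def nilprogSet {G : Type u} [Group G] {r : ℕ} (v : Fin r → G) (N : Fin r → ℝ) : Set G :=
  { g | ∃ w : List (Fin r × Bool),
      (∀ i : Fin r, ((w.filter fun p => p.1 = i).length : ℝ) ≤ N i) ∧
      (w.map fun p => if p.2 then v p.1 else (v p.1)⁻¹).prod = g }

/-- The `C`-normal form conditions for a nilprogression `P(u₁,…,u_r;N₁,…,N_r)`:
(i) upper-triangular form, with the commutator convention `[g,h] = g⁻¹h⁻¹gh`;
(ii) local properness; (iii) the volume bound. -/
def NilprogNormalForm {G : Type u} [Group G] {r : ℕ} (u : Fin r → G) (N : Fin r → ℝ)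
    (C : ℝ) : Prop :=
  (∀ i j : Fin r, i < j → ∀ a b : Bool,
      ((if a then u i else (u i)⁻¹)⁻¹ * (if b then u j else (u j)⁻¹)⁻¹ *
          (if a then u i else (u i)⁻¹) * (if b then u j else (u j)⁻¹)) ∈
        nilprogSet u fun k => if j < k then C * N k / (N i * N j) else 0) ∧
  (∀ n n' : Fin r → ℤ, (∀ i, |(n i : ℝ)| ≤ N i / C) → (∀ i, |(n' i : ℝ)| ≤ N i / C) →
      (List.ofFn fun i => u i ^ n i).prod = (List.ofFn fun i => u i ^ n' i).prod → n = n') ∧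
  C⁻¹ * ∏ i, ((2 * ⌊N i⌋ + 1 : ℤ) : ℝ) ≤ (Nat.card (nilprogSet u N) : ℝ) ∧
  (Nat.card (nilprogSet u N) : ℝ) ≤ C * ∏ i, ((2 * ⌊N i⌋ + 1 : ℤ) : ℝ)

/-- The data of a coset nilprogression `HP` in `G`: a finite subgroup `H`, and elements
`v₁,…,v_r` of the normaliser `N(H)` together with positive reals `N₁,…,N_r`, whose images in
`N(H)/H` will give the associated nilprogression. -/
structure CosetNilprog (G : Type u) [Group G] where
  H : Subgroup G
  Hfin : (H : Set G).Finite
  r : ℕ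
  v : Fin r → G
  v_mem : ∀ i, v i ∈ Subgroup.normalizer (H : Set G)
  N : Fin r → ℝ
  N_pos : ∀ i, 0 < N i

namespace CosetNilprog

variable {G : Type u} [Group G] (Q : CosetNilprog G)

/-- The quotient group `N(H)/H`. -/
abbrev Qt : Type u := Subgroup.normalizer (Q.H : Set G) ⧸ Q.H.subgroupOf (Subgroup.normalizer (Q.H : Set G))

/-- The images `v̄ᵢ` of the generators in `N(H)/H`. -/
def vbar (i : Fin Q.r) : Q.Qt := QuotientGroup.mk ⟨Q.v i, Q.v_mem i⟩

/-- The generators of the quotient nilprogression generate a nilpotent group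
(part of the definition of a (coset) nilprogression). -/
def IsNilprog : Prop := Group.IsNilpotent ↥(Subgroup.closure (Set.range Q.vbar))

/-- The nilpotency class of the coset nilprogression is at most `s`. -/
def ClassLE (s : ℕ) : Prop :=
  Subgroup.lowerCentralSeries (⊤ : Subgroup ↥(Subgroup.closure (Set.range Q.vbar))) s = ⊥

/-- The coset nilprogression is in `C`-normal form, i.e. its quotient nilprogression is. -/
def InNormalForm (C : ℝ) : Prop := NilprogNormalForm Q.vbar Q.N C

/-- The dilated coset nilprogression `HP^t`: the preimage in `N(H)` of the dilated
nilprogression `(HP/H)^t`, regarded as a subset of `G`. -/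
def setT (t : ℝ) : Set G :=
  { g | ∃ hg : g ∈ Subgroup.normalizer (Q.H : Set G),
      (QuotientGroup.mk ⟨g, hg⟩ : Q.Qt) ∈ nilprogSet Q.vbar fun i => t * Q.N i }

/-- The coset nilprogression `HP` itself, as a subset of `G`. -/
def carrier : Set G := Q.setT 1

/-- The "seminorm" `‖g‖_{HP} = inf { t ∈ [0,∞] : g ∈ HP^t }`, valued in `[0,∞]`. -/
noncomputable def nnorm (g : G) : ℝ≥0∞ :=
  sInf (ENNReal.ofReal '' { t : ℝ | 0 < t ∧ g ∈ Q.setT t })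

/-- The "virtual seminorm" `‖g‖_{HP,X} = inf_{σ ∈ Sym(X)} sup_{x ∈ X} ‖σ(x)⁻¹ g x‖_{HP}`. -/
noncomputable def snorm (X : Finset G) (g : G) : ℝ≥0∞ :=
  ⨅ σ : Equiv.Perm { x // x ∈ X }, ⨆ x : { x // x ∈ X }, Q.nnorm ((σ x : G)⁻¹ * g * (x : G))

end CosetNilprog

/-- The convolution `μ * ν (x) = ∑_y μ(y) ν(y⁻¹ x)` of two discrete measures on a group. -/
noncomputable def mconv {G : Type u} [Group G] (μ ν : G → ℝ) : G → ℝ :=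
  fun x => ∑' y, μ y * ν (y⁻¹ * x)

/-- The `n`-fold convolution power `μ^{*n}` (with `μ^{*0}` the point mass at the identity). -/
noncomputable def mconvPow {G : Type u} [Group G] [DecidableEq G] (μ : G → ℝ) : ℕ → G → ℝ
  | 0 => fun x => if x = 1 then 1 else 0
  | n + 1 => mconv μ (mconvPow μ n)

section analytic

theorem two_mul_le_sq_ennreal (p q : ℝ≥0∞) : 2 * (p * q) ≤ p ^ 2 + q ^ 2 := by
  rcases le_total p q with h | h
  · obtain ⟨e, rfl⟩ := exists_add_of_le h
    have : p ^ 2 + (p + e) ^ 2 = 2 * (p * (p + e)) + e ^ 2 := by ring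
    rw [this]; exact le_self_add
  · obtain ⟨e, rfl⟩ := exists_add_of_le h
    have : (q + e) ^ 2 + q ^ 2 = 2 * ((q + e) * q) + e ^ 2 := by ring
    rw [this]; exact le_self_add

theorem sq_add_sq_le_ennreal (a b d : ℝ≥0∞) (h1 : a ≤ b + d) (h2 : b ≤ a + d)
    (ha : a ≠ ⊤) (hb : b ≠ ⊤) : a ^ 2 + b ^ 2 ≤ 2 * (a * b) + d ^ 2 := by
  rcases le_total a b with h | h
  · obtain ⟨e, rfl⟩ := exists_add_of_le h
    have he : e ≤ d := (ENNReal.add_le_add_iff_left ha).1 h2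
    have : a ^ 2 + (a + e) ^ 2 = 2 * (a * (a + e)) + e ^ 2 := by ring
    rw [this]; gcongr
  · obtain ⟨e, rfl⟩ := exists_add_of_le h
    have he : e ≤ d := (ENNReal.add_le_add_iff_left hb).1 h1
    have : (b + e) ^ 2 + b ^ 2 = 2 * ((b + e) * b) + e ^ 2 := by ring
    rw [this]; gcongr

theorem weighted_cs {ι : Type*} (w a b : ι → ℝ≥0∞) :
    (∑' x, w x * (a x * b x)) ^ 2 ≤ (∑' x, w x * a x ^ 2) * (∑' x, w x * b x ^ 2) := by
  have key : 2 * (∑' x, w x * (a x * b x)) ^ 2 ≤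
      2 * ((∑' x, w x * a x ^ 2) * (∑' x, w x * b x ^ 2)) := by
    have e1 : (∑' x, w x * (a x * b x)) ^ 2
        = ∑' x, ∑' y, (w x * (a x * b x)) * (w y * (a y * b y)) := by
      rw [sq, ← ENNReal.tsum_mul_right]
      simp_rw [ENNReal.tsum_mul_left]
    have e2 : (∑' x, w x * a x ^ 2) * (∑' x, w x * b x ^ 2)
        = ∑' x, ∑' y, (w x * a x ^ 2) * (w y * b y ^ 2) := by
      rw [← ENNReal.tsum_mul_right]
      simp_rw [ENNReal.tsum_mul_left]
    have e3 : (∑' x, w x * a x ^ 2) * (∑' x, w x * b x ^ 2)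
        = ∑' x, ∑' y, (w y * a y ^ 2) * (w x * b x ^ 2) := by
      rw [e2, ENNReal.tsum_comm]
    rw [two_mul ((∑' x, w x * a x ^ 2) * _)]
    nth_rewrite 1 [e2]
    rw [e3, e1, ← ENNReal.tsum_add, ← ENNReal.tsum_mul_left]
    refine ENNReal.tsum_le_tsum fun x => ?_
    rw [← ENNReal.tsum_add, ← ENNReal.tsum_mul_left]
    refine ENNReal.tsum_le_tsum fun y => ?_
    calc 2 * (w x * (a x * b x) * (w y * (a y * b y)))
        = w x * w y * (2 * ((a x * b y) * (a y * b x))) := by ring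
      _ ≤ w x * w y * ((a x * b y) ^ 2 + (a y * b x) ^ 2) := by
          gcongr; exact two_mul_le_sq_ennreal _ _
      _ = _ := by ring
  exact (ENNReal.mul_le_mul_iff_right (by norm_num) (by norm_num)).1 key

theorem cs_ennreal {ι : Type*} (a b : ι → ℝ≥0∞) :
    (∑' x, a x * b x) ^ 2 ≤ (∑' x, a x ^ 2) * (∑' x, b x ^ 2) := by
  simpa using weighted_cs (fun _ => 1) a b

variable {G : Type u} [Group G]

/-- Convolution in `ℝ≥0∞`. -/
noncomputable def econv (m f : G → ℝ≥0∞) : G → ℝ≥0∞ := fun x => ∑' y, m y * f (y⁻¹ * x)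

theorem tsum_translate (f : G → ℝ≥0∞) (y : G) : ∑' x, f (y * x) = ∑' x, f x :=
  (Equiv.mulLeft y).tsum_eq f

theorem econv_assoc (m ν f : G → ℝ≥0∞) : econv (econv m ν) f = econv m (econv ν f) := by
  funext x
  unfold econv
  simp_rw [← ENNReal.tsum_mul_right, ← ENNReal.tsum_mul_left]
  rw [ENNReal.tsum_comm]
  refine tsum_congr fun y => ?_
  rw [← tsum_translate _ y]
  refine tsum_congr fun z => ?_
  simp [mul_assoc]

theorem econv_selfadj (m f h : G → ℝ≥0∞) (hm : ∀ x, m x⁻¹ = m x) :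
    ∑' x, econv m f x * h x = ∑' x, f x * econv m h x := by
  unfold econv
  simp_rw [← ENNReal.tsum_mul_right, ← ENNReal.tsum_mul_left]
  rw [ENNReal.tsum_comm]
  conv_rhs => rw [ENNReal.tsum_comm, ← (Equiv.inv G).tsum_eq]
  refine tsum_congr fun y => ?_
  rw [← tsum_translate _ y]
  refine tsum_congr fun x => ?_
  simp [hm]; ring

theorem econv_sq_le (ν f : G → ℝ≥0∞) :
    ∑' x, econv ν f x ^ 2 ≤ (∑' x, ν x ^ 2) * (∑' x, f x) ^ 2 := by
  have h1 : ∀ x, econv ν f x ^ 2 ≤ (∑' z, f (z⁻¹ * x) * ν z ^ 2) * ∑' z, f z := by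
    intro x
    have := weighted_cs (fun z => f (z⁻¹ * x)) ν (fun _ => 1)
    simp only [mul_one, one_pow] at this
    have e : ∑' z, f (z⁻¹ * x) = ∑' z, f z := by
      rw [← ((Equiv.inv G).trans (Equiv.mulRight x)).tsum_eq f]
      simp
    rw [e] at this
    unfold econv
    simpa [mul_comm] using this
  calc _ ≤ ∑' x, (∑' z, f (z⁻¹ * x) * ν z ^ 2) * ∑' z, f z := ENNReal.tsum_le_tsum h1
    _ = (∑' x, ∑' z, f (z⁻¹ * x) * ν z ^ 2) * ∑' z, f z := ENNReal.tsum_mul_right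
    _ = (∑' z, (∑' x, f x) * ν z ^ 2) * ∑' z, f z := by
        rw [ENNReal.tsum_comm]
        congr 1
        refine tsum_congr fun z => ?_
        rw [ENNReal.tsum_mul_right, tsum_translate]
    _ = _ := by rw [ENNReal.tsum_mul_left]; ring

/-- Energy estimate. -/
theorem energy (m f d : G → ℝ≥0∞) (hm1 : ∑' x, m x = 1) (hm : ∀ x, m x⁻¹ = m x)
    (S : Finset G) (hf1 : ∀ x, f x ≤ 1) (hfS : ∀ x, x ∉ S → f x = 0)
    (hL : ∀ g x, f (g * x) ≤ f x + d g) (hL' : ∀ g x, f x ≤ f (g * x) + d g) :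
    ∑' x, f x ^ 2 ≤ ∑' x, f x * econv m f x + S.card * ∑' g, d g ^ 2 * m g := by
  classical
  have hpt : ∀ g x, f x ^ 2 + f (g * x) ^ 2 ≤ 2 * (f x * f (g * x)) +
      d g ^ 2 * ((if x ∈ S then 1 else 0) + (if g * x ∈ S then 1 else 0)) := by
    intro g x
    have hA : ∀ x, f x ≠ ⊤ := fun x => ne_top_of_le_ne_top ENNReal.one_ne_top (hf1 x)
    have := sq_add_sq_le_ennreal (f x) (f (g * x)) (d g) (hL' g x) (hL g x) (hA _) (hA _)
    by_cases h1 : x ∈ S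
    · refine this.trans ?_
      gcongr
      simp only [h1, if_true]
      exact le_mul_of_one_le_right' le_self_add
    · by_cases h2 : g * x ∈ S
      · refine this.trans ?_
        gcongr
        simp [h1, h2]
      · simp [hfS _ h1, hfS _ h2]
  have hS : ∑' x, (if x ∈ S then (1 : ℝ≥0∞) else 0) = S.card := by
    rw [tsum_eq_sum (s := S) (fun x hx => by simp [hx])]; simp
  have hg : ∀ g, ∑' x, f x ^ 2 ≤ ∑' x, f x * f (g * x) + S.card * d g ^ 2 := by
    intro g
    have h := ENNReal.tsum_le_tsum (hpt g)
    rw [ENNReal.tsum_add, ENNReal.tsum_add, ENNReal.tsum_mul_left, ENNReal.tsum_mul_left,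
      ENNReal.tsum_add, tsum_translate (fun x => f x ^ 2) g,
      tsum_translate (fun x => if x ∈ S then (1 : ℝ≥0∞) else 0) g, hS] at h
    have h' : 2 * (∑' x, f x ^ 2) ≤ 2 * (∑' x, f x * f (g * x) + S.card * d g ^ 2) := by
      calc _ = ∑' x, f x ^ 2 + ∑' x, f x ^ 2 := by ring
        _ ≤ _ := h
        _ = _ := by ring
    exact (ENNReal.mul_le_mul_iff_right (by norm_num) (by norm_num)).1 h'
  calc ∑' x, f x ^ 2 = ∑' g, m g * ∑' x, f x ^ 2 := by rw [ENNReal.tsum_mul_right, hm1, one_mul]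
    _ ≤ ∑' g, m g * (∑' x, f x * f (g * x) + S.card * d g ^ 2) := by gcongr with g; exact hg g
    _ = ∑' g, m g * ∑' x, f x * f (g * x) + S.card * ∑' g, d g ^ 2 * m g := by
        simp_rw [mul_add]
        rw [ENNReal.tsum_add, ← ENNReal.tsum_mul_left]
        congr 1
        refine tsum_congr fun g => by ring
    _ = _ := by
        congr 1
        unfold econv
        simp_rw [← ENNReal.tsum_mul_left]
        rw [ENNReal.tsum_comm]
        refine tsum_congr fun x => ?_
        rw [← (Equiv.inv G).tsum_eq]
        refine tsum_congr fun g => ?_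
        simp [hm]; ring

/-- Iterated convolution operator applied to `f`. -/
noncomputable def eiter (m f : G → ℝ≥0∞) : ℕ → G → ℝ≥0∞
  | 0 => f
  | n + 1 => econv m (eiter m f n)

theorem eiter_logconvex (m f : G → ℝ≥0∞) (hm : ∀ x, m x⁻¹ = m x) (k : ℕ) :
    (∑' x, eiter m f (k + 1) x ^ 2) ^ 2 ≤
      (∑' x, eiter m f k x ^ 2) * (∑' x, eiter m f (k + 2) x ^ 2) := by
  have : ∑' x, eiter m f (k + 1) x ^ 2 = ∑' x, eiter m f k x * eiter m f (k + 2) x := by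
    have := econv_selfadj m (eiter m f k) (eiter m f (k + 1)) hm
    simp only [sq]
    exact this
  rw [this]
  exact cs_ennreal _ _

theorem logconvex_real (b : ℕ → ℝ) (ρ : ℝ) (hρ : 0 < ρ) (hb0 : 0 < b 0)
    (h1 : ρ * b 0 ≤ b 1) (h : ∀ k, b (k + 1) ^ 2 ≤ b k * b (k + 2)) (n : ℕ) :
    ρ ^ n * b 0 ≤ b n := by
  have key : ∀ k, 0 < b k ∧ ρ * b k ≤ b (k + 1) := by
    intro k
    induction k with
    | zero => exact ⟨hb0, h1⟩
    | succ k ih =>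
      obtain ⟨hk, hk1⟩ := ih
      have hp : 0 < b (k + 1) := lt_of_lt_of_le (by positivity) hk1
      refine ⟨hp, ?_⟩
      have := h k
      have h2 : ρ * b k * b (k + 1) ≤ b k * b (k + 2) := by nlinarith
      have h3 : b k * (ρ * b (k + 1)) ≤ b k * b (k + 2) := by linarith
      exact le_of_mul_le_mul_left h3 hk
  induction n with
  | zero => simp
  | succ n ih =>
    calc ρ ^ (n + 1) * b 0 = ρ * (ρ ^ n * b 0) := by ring
      _ ≤ ρ * b n := by gcongr
      _ ≤ _ := (key n).2

theorem exp_le_one_sub (x : ℝ) (h0 : 0 ≤ x) (h1 : x ≤ 1 / 2) : Real.exp (-(2 * x)) ≤ 1 - x := by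
  rw [Real.exp_neg]
  have := Real.add_one_le_exp (2 * x)
  rw [inv_le_comm₀ (Real.exp_pos _) (by linarith)]
  refine le_trans ?_ this
  rw [inv_le_iff_one_le_mul₀ (by linarith)]
  nlinarith

theorem eiter_eq (m f : G → ℝ≥0∞) (ν : ℕ → G → ℝ≥0∞) (h0 : econv (ν 0) f = f)
    (hs : ∀ n, ν (n + 1) = econv m (ν n)) (n : ℕ) : eiter m f n = econv (ν n) f := by
  induction n with
  | zero => exact h0.symm
  | succ n ih => rw [hs, econv_assoc, ← ih]; rfl

/-- The spectral argument: for large `n`. -/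
theorem spectral_bound (m f d : G → ℝ≥0∞) (hm1 : ∑' x, m x = 1) (hm : ∀ x, m x⁻¹ = m x)
    (ν : ℕ → G → ℝ≥0∞) (h0 : econv (ν 0) f = f)
    (hs : ∀ n, ν (n + 1) = econv m (ν n)) (hν : ∀ n, ∑' x, ν n x ^ 2 ≤ 1)
    (S : Finset G) (hf1 : ∀ x, f x ≤ 1) (hfS : ∀ x, x ∉ S → f x = 0)
    (hL : ∀ g x, f (g * x) ≤ f x + d g) (hL' : ∀ g x, f x ≤ f (g * x) + d g)
    (n : ℕ) (M K E : ℝ) (hM : 0 ≤ M) (hn : 1 ≤ n) (hE : 0 < E)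
    (hd : ∑' g, d g ^ 2 * m g ≤ ENNReal.ofReal (M / n))
    (hEf : ENNReal.ofReal E ≤ ∑' x, f x ^ 2)
    (hK : M * S.card ≤ K * E) (hKn : 2 * K ≤ n) :
    Real.exp (-(4 * K)) * E ≤ (∑' x, ν n x ^ 2).toReal * (S.card : ℝ) ^ 2 := by
  classical
  have hsumf : ∑' x, f x ≤ S.card := by
    rw [tsum_eq_sum (s := S) (fun x hx => hfS x hx)]
    calc ∑ x ∈ S, f x ≤ ∑ x ∈ S, 1 := Finset.sum_le_sum fun x _ => hf1 x
      _ = _ := by simp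
  have hbound : ∀ k, ∑' x, eiter m f k x ^ 2 ≤ (∑' x, ν k x ^ 2) * (S.card : ℝ≥0∞) ^ 2 := by
    intro k
    rw [eiter_eq m f ν h0 hs k]
    exact (econv_sq_le _ _).trans (by gcongr)
  have hfin : ∀ k, ∑' x, eiter m f k x ^ 2 ≠ ⊤ := by
    intro k
    refine ne_top_of_le_ne_top ?_ (hbound k)
    exact ENNReal.mul_ne_top (ne_top_of_le_ne_top ENNReal.one_ne_top (hν k)) (by simp)
  set b : ℕ → ℝ := fun k => (∑' x, eiter m f k x ^ 2).toReal with hb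
  have hlc : ∀ k, b (k + 1) ^ 2 ≤ b k * b (k + 2) := by
    intro k
    have := ENNReal.toReal_mono (ENNReal.mul_ne_top (hfin _) (hfin _)) (eiter_logconvex m f hm k)
    rwa [ENNReal.toReal_mul, ENNReal.toReal_pow] at this
  have hEb : E ≤ b 0 := by
    have := ENNReal.toReal_mono (hfin 0) hEf
    rwa [ENNReal.toReal_ofReal hE.le] at this
  have hb0 : 0 < b 0 := lt_of_lt_of_le hE hEb
  have hn' : (0 : ℝ) < n := by exact_mod_cast hn
  have hK0 : 0 ≤ K := by
    by_contra hcon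
    push Not at hcon
    have : 0 ≤ M * S.card := by positivity
    nlinarith
  have hen := energy m f d hm1 hm S hf1 hfS hL hL'
  have hcs := cs_ennreal f (econv m f)
  set a := ∑' x, f x * econv m f x with ha
  have ha_fin : a ≠ ⊤ := by
    intro h
    rw [h] at hcs
    have : (∑' x, f x ^ 2) * ∑' x, econv m f x ^ 2 ≠ ⊤ := ENNReal.mul_ne_top (hfin 0) (hfin 1)
    exact this (top_le_iff.1 (by simpa using hcs))
  have ha1 : a.toReal ^ 2 ≤ b 0 * b 1 := by
    have := ENNReal.toReal_mono (ENNReal.mul_ne_top (hfin 0) (hfin 1)) hcs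
    rwa [ENNReal.toReal_mul, ENNReal.toReal_pow] at this
  have ha2 : b 0 ≤ a.toReal + S.card * (M / n) := by
    have h2 : ∑' x, f x ^ 2 ≤ a + S.card * ENNReal.ofReal (M / n) := hen.trans (by gcongr)
    have hfin2 : (S.card : ℝ≥0∞) * ENNReal.ofReal (M / n) ≠ ⊤ :=
      ENNReal.mul_ne_top (by simp) (by simp)
    have := ENNReal.toReal_mono (ENNReal.add_ne_top.2 ⟨ha_fin, hfin2⟩) h2
    rw [ENNReal.toReal_add ha_fin hfin2, ENNReal.toReal_mul,
      ENNReal.toReal_ofReal (by positivity), ENNReal.toReal_natCast] at this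
    exact this
  set x := K / n with hx
  have hx0 : 0 ≤ x := by positivity
  have hx1 : x ≤ 1 / 2 := by rw [hx, div_le_iff₀ hn']; linarith
  have ha3 : (1 - x) * b 0 ≤ a.toReal := by
    have : (S.card : ℝ) * (M / n) ≤ x * b 0 := by
      calc (S.card : ℝ) * (M / n) = (M * S.card) / n := by ring
        _ ≤ (K * E) / n := by gcongr
        _ = x * E := by rw [hx]; ring
        _ ≤ _ := by gcongr
    linarith
  have hr : 0 < (1 - x) ^ 2 := by
    have : 0 < 1 - x := by linarith
    positivity
  have h1 : (1 - x) ^ 2 * b 0 ≤ b 1 := by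
    have h4 : ((1 - x) * b 0) ^ 2 ≤ a.toReal ^ 2 := by
      have : 0 ≤ 1 - x := by linarith
      gcongr
    have h5 : b 0 * ((1 - x) ^ 2 * b 0) ≤ b 0 * b 1 := by nlinarith
    exact le_of_mul_le_mul_left h5 hb0
  have hfinal := logconvex_real b _ hr hb0 h1 hlc n
  have hexp : Real.exp (-(4 * K)) ≤ ((1 - x) ^ 2) ^ n := by
    have h6 := exp_le_one_sub x hx0 hx1
    calc Real.exp (-(4 * K)) = (Real.exp (-(2 * x)) ^ 2) ^ n := by
          rw [← Real.exp_nat_mul, ← Real.exp_nat_mul]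
          congr 1
          rw [hx]; field_simp; push_cast; ring
      _ ≤ _ := by gcongr
  calc Real.exp (-(4 * K)) * E ≤ ((1 - x) ^ 2) ^ n * b 0 := by gcongr
    _ ≤ b n := hfinal
    _ ≤ _ := by
      have := ENNReal.toReal_mono (ENNReal.mul_ne_top
        (ne_top_of_le_ne_top ENNReal.one_ne_top (hν n)) (by simp)) (hbound n)
      rw [ENNReal.toReal_mul, ENNReal.toReal_pow] at this
      simpa using this

/-- Small `n`: mass of sets. -/
theorem mass_bound (m : G → ℝ≥0∞) (ν : ℕ → G → ℝ≥0∞) (hs : ∀ n, ν (n + 1) = econv m (ν n))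
    (A : Set G) (D : ℕ → Set G) (c : ℝ≥0∞)
    (hA : c ≤ ∑' g, A.indicator m g) (h0 : 1 ≤ ∑' g, (D 0).indicator (ν 0) g)
    (hD : ∀ n, ∀ g ∈ A, ∀ y ∈ D n, g * y ∈ D (n + 1)) (n : ℕ) :
    c ^ n ≤ ∑' g, (D n).indicator (ν n) g := by
  induction n with
  | zero => simpa using h0
  | succ n ih =>
    calc c ^ (n + 1) = c * c ^ n := by ring
      _ ≤ (∑' g, A.indicator m g) * ∑' y, (D n).indicator (ν n) y := by gcongr
      _ = ∑' g, ∑' y, A.indicator m g * (D n).indicator (ν n) (g⁻¹ * y) := by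
          rw [← ENNReal.tsum_mul_right]
          refine tsum_congr fun g => ?_
          rw [ENNReal.tsum_mul_left, tsum_translate]
      _ ≤ ∑' y, (D (n + 1)).indicator (ν (n + 1)) y := by
          rw [ENNReal.tsum_comm]
          refine ENNReal.tsum_le_tsum fun y => ?_
          by_cases hy : y ∈ D (n + 1)
          · rw [Set.indicator_of_mem hy, hs]
            unfold econv
            refine ENNReal.tsum_le_tsum fun g => ?_
            gcongr
            · exact Set.indicator_le_self _ _ _
            · exact Set.indicator_le_self _ _ _
          · have : ∀ g, A.indicator m g * (D n).indicator (ν n) (g⁻¹ * y) = 0 := by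
              intro g
              by_cases hg : g ∈ A
              · by_cases h2 : g⁻¹ * y ∈ D n
                · exact absurd (by simpa using hD n g hg _ h2) hy
                · simp [h2]
              · simp [hg]
            simp [this]

theorem mass_cs (ν : G → ℝ≥0∞) (D : Set G) (S : Finset G) (hDS : D ⊆ S) (c : ℝ≥0∞)
    (h : c ≤ ∑' g, D.indicator ν g) : c ^ 2 ≤ (∑' x, ν x ^ 2) * S.card := by
  classical
  have h1 : ∑' g, D.indicator ν g ≤ ∑' g, ν g * (if g ∈ S then 1 else 0) := by
    refine ENNReal.tsum_le_tsum fun g => ?_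
    by_cases hg : g ∈ D
    · have : g ∈ S := hDS hg
      simp [hg, this]
    · simp [hg]
  calc c ^ 2 ≤ (∑' g, ν g * (if g ∈ S then 1 else 0)) ^ 2 := by gcongr; exact h.trans h1
    _ ≤ _ := cs_ennreal _ _
    _ = _ := by
      congr 1
      rw [tsum_eq_sum (s := S) (fun x hx => by simp [hx])]; simp

end analytic

section nil

variable {G : Type u} [Group G] {r : ℕ}

/-- Evaluation of a word. -/
def evalW (v : Fin r → G) (w : List (Fin r × Bool)) : G :=
  (w.map fun p => if p.2 then v p.1 else (v p.1)⁻¹).prod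

/-- Weight of a word. -/
noncomputable def wt (N : Fin r → ℝ) (w : List (Fin r × Bool)) : ℝ := (w.map fun p => (N p.1)⁻¹).sum

/-- Number of occurrences of a letter. -/
def occ (i : Fin r) (w : List (Fin r × Bool)) : ℕ := (w.filter fun p => p.1 = i).length

theorem evalW_append (v : Fin r → G) (w w' : List (Fin r × Bool)) :
    evalW v (w ++ w') = evalW v w * evalW v w' := by simp [evalW]

theorem evalW_cons (v : Fin r → G) (p) (w : List (Fin r × Bool)) :
    evalW v (p :: w) = (if p.2 then v p.1 else (v p.1)⁻¹) * evalW v w := by simp [evalW]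

theorem wt_append (N : Fin r → ℝ) (w w' : List (Fin r × Bool)) :
    wt N (w ++ w') = wt N w + wt N w' := by simp [wt]

theorem wt_cons (N : Fin r → ℝ) (p) (w : List (Fin r × Bool)) :
    wt N (p :: w) = (N p.1)⁻¹ + wt N w := by simp [wt]

theorem occ_append (i : Fin r) (w w' : List (Fin r × Bool)) :
    occ i (w ++ w') = occ i w + occ i w' := by simp [occ]

theorem occ_cons (i : Fin r) (p) (w : List (Fin r × Bool)) :
    occ i (p :: w) = (if p.1 = i then 1 else 0) + occ i w := by
  by_cases h : p.1 = i
  · simp [occ, h]; ring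
  · simp [occ, h]

/-- Formal inverse of a word. -/
def invW (w : List (Fin r × Bool)) : List (Fin r × Bool) := (w.map fun p => (p.1, !p.2)).reverse

theorem evalW_inv (v : Fin r → G) (w : List (Fin r × Bool)) : evalW v (invW w) = (evalW v w)⁻¹ := by
  induction w with
  | nil => simp [evalW, invW]
  | cons p w ih =>
    have : invW (p :: w) = invW w ++ [(p.1, !p.2)] := by simp [invW]
    rw [this, evalW_append, ih, evalW_cons v p w, mul_inv_rev, evalW_cons]
    cases h : p.2 <;> simp [evalW]

theorem occ_inv (i : Fin r) (w : List (Fin r × Bool)) : occ i (invW w) = occ i w := by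
  induction w with
  | nil => simp [occ, invW]
  | cons p w ih =>
    have : invW (p :: w) = invW w ++ [(p.1, !p.2)] := by simp [invW]
    rw [this, occ_append, ih, occ_cons, occ_cons]
    simp [occ]; ring

theorem mem_nilprogSet_iff (v : Fin r → G) (N : Fin r → ℝ) (g : G) :
    g ∈ nilprogSet v N ↔ ∃ w, (∀ i, (occ i w : ℝ) ≤ N i) ∧ evalW v w = g := Iff.rfl

theorem nilprogSet_mono (v : Fin r → G) {N N' : Fin r → ℝ} (h : ∀ i, N i ≤ N' i) :
    nilprogSet v N ⊆ nilprogSet v N' := fun _ ⟨w, hw, e⟩ => ⟨w, fun i => (hw i).trans (h i), e⟩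

theorem nilprogSet_mul (v : Fin r → G) {N N' : Fin r → ℝ} {g h : G} (hg : g ∈ nilprogSet v N)
    (hh : h ∈ nilprogSet v N') : g * h ∈ nilprogSet v (fun i => N i + N' i) := by
  rw [mem_nilprogSet_iff] at *
  obtain ⟨w, hw, rfl⟩ := hg
  obtain ⟨w', hw', rfl⟩ := hh
  refine ⟨w ++ w', fun i => ?_, evalW_append _ _ _⟩
  rw [occ_append]; push_cast
  exact add_le_add (hw i) (hw' i)

theorem nilprogSet_inv (v : Fin r → G) {N : Fin r → ℝ} {g : G} (hg : g ∈ nilprogSet v N) :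
    g⁻¹ ∈ nilprogSet v N := by
  rw [mem_nilprogSet_iff] at *
  obtain ⟨w, hw, rfl⟩ := hg
  exact ⟨invW w, fun i => by rw [occ_inv]; exact hw i, evalW_inv _ _⟩

theorem nilprogSet_one (v : Fin r → G) {N : Fin r → ℝ} (h : ∀ i, 0 ≤ N i) :
    (1 : G) ∈ nilprogSet v N := ⟨[], by simpa using h, by simp⟩

theorem wt_eq_sum (N : Fin r → ℝ) (w : List (Fin r × Bool)) :
    wt N w = ∑ i, occ i w * (N i)⁻¹ := by
  induction w with
  | nil => simp [wt, occ]
  | cons p w ih =>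
    rw [wt_cons, ih]
    simp_rw [occ_cons]
    push_cast
    simp_rw [add_mul]
    rw [Finset.sum_add_distrib]
    simp

/-- Elements represented by words in letters of index `≥ i` with weight at most `W`. -/
def wset (u : Fin r → G) (N : Fin r → ℝ) (i : ℕ) (W : ℝ) : Set G :=
  { g | ∃ w : List (Fin r × Bool), (∀ p ∈ w, i ≤ (p.1 : ℕ)) ∧ wt N w ≤ W ∧ evalW u w = g }

theorem wset_mono (u : Fin r → G) (N : Fin r → ℝ) (i : ℕ) {W W' : ℝ} (h : W ≤ W') :
    wset u N i W ⊆ wset u N i W' := fun _ ⟨w, a, b, c⟩ => ⟨w, a, b.trans h, c⟩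

theorem wset_mul (u : Fin r → G) (N : Fin r → ℝ) (i : ℕ) {W W' : ℝ} {g h : G}
    (hg : g ∈ wset u N i W) (hh : h ∈ wset u N i W') : g * h ∈ wset u N i (W + W') := by
  obtain ⟨w, a, b, rfl⟩ := hg
  obtain ⟨w', a', b', rfl⟩ := hh
  refine ⟨w ++ w', ?_, ?_, evalW_append _ _ _⟩
  · intro p hp
    rcases List.mem_append.1 hp with h | h
    exacts [a p h, a' p h]
  · rw [wt_append]; linarith

theorem nilprogSet_sub_wset (u : Fin r → G) (N : Fin r → ℝ) (hN : ∀ i, 0 < N i) (R : ℝ) :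
    nilprogSet u (fun i => R * N i) ⊆ wset u N 0 (r * R) := by
  rintro g hg
  obtain ⟨w, hw, rfl⟩ := (mem_nilprogSet_iff _ _ _).1 hg
  refine ⟨w, by simp, ?_, rfl⟩
  rw [wt_eq_sum]
  calc ∑ i, (occ i w : ℝ) * (N i)⁻¹ ≤ ∑ i : Fin r, R := by
        refine Finset.sum_le_sum fun i _ => ?_
        rw [← div_eq_mul_inv, div_le_iff₀ (hN i)]
        exact hw i
    _ = _ := by simp

/-- The upper-triangular condition. -/
def UpTri (u : Fin r → G) (N : Fin r → ℝ) (C : ℝ) : Prop :=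
  ∀ i j : Fin r, i < j → ∀ a b : Bool,
      ((if a then u i else (u i)⁻¹)⁻¹ * (if b then u j else (u j)⁻¹)⁻¹ *
          (if a then u i else (u i)⁻¹) * (if b then u j else (u j)⁻¹)) ∈
        nilprogSet u fun k => if j < k then C * N k / (N i * N j) else 0

theorem conj_letter (u : Fin r → G) (N : Fin r → ℝ) (hN : ∀ i, 0 < N i) {C : ℝ} (hC : 1 ≤ C)
    (h : UpTri u N C) (i j : Fin r) (hij : i < j) (a b : Bool) :
    (if a then u i else (u i)⁻¹)⁻¹ * (if b then u j else (u j)⁻¹) * (if a then u i else (u i)⁻¹)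
      ∈ wset u N (i + 1) ((N j)⁻¹ * (1 + r * C / N i)) := by
  have h1 := nilprogSet_inv u (h i j hij a b)
  set x := (if a then u i else (u i)⁻¹)
  set y := (if b then u j else (u j)⁻¹) with hy
  obtain ⟨w, hw, e⟩ := (mem_nilprogSet_iff _ _ _).1 h1
  have e2 : x⁻¹ * y * x = evalW u ((j, b) :: w) := by
    rw [evalW_cons, e]
    simp only [← hy]
    group
  refine ⟨(j, b) :: w, ?_, ?_, e2.symm⟩
  · intro p hp
    rcases List.mem_cons.1 hp with rfl | hp
    · exact hij
    · have := hw p.1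
      by_contra hcon
      have hnot : ¬ j < p.1 := by
        intro hj
        have : (i : ℕ) < j := hij
        have : (j : ℕ) < p.1 := hj
        omega
      rw [if_neg hnot] at this
      have h0 : occ p.1 w = 0 := by
        have h0 : (occ p.1 w : ℝ) = 0 := le_antisymm this (by positivity)
        exact_mod_cast h0
      have : p ∈ w.filter fun q => q.1 = p.1 := by simp [hp]
      rw [List.eq_nil_of_length_eq_zero h0] at this
      simp at this
  · rw [wt_cons, wt_eq_sum]
    have hb : ∑ k, (occ k w : ℝ) * (N k)⁻¹ ≤ ∑ k : Fin r, C / (N i * N j) := by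
      refine Finset.sum_le_sum fun k _ => ?_
      have hk := hN k
      have hi := hN i
      have hj := hN j
      rw [← div_eq_mul_inv, div_le_iff₀ hk]
      refine (hw k).trans ?_
      split_ifs
      · apply le_of_eq; ring
      · positivity
    have : ∑ k : Fin r, C / (N i * N j) = (N j)⁻¹ * (r * C / N i) := by
      have hi := (hN i).ne'
      have hj := (hN j).ne'
      simp; field_simp
    rw [this] at hb
    simp only
    linarith

theorem conj_word (u : Fin r → G) (N : Fin r → ℝ) (hN : ∀ i, 0 < N i) {C : ℝ} (hC : 1 ≤ C)
    (h : UpTri u N C) (i : Fin r) (a : Bool) {W : ℝ} {g : G} (hg : g ∈ wset u N (i + 1) W) :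
    (if a then u i else (u i)⁻¹)⁻¹ * g * (if a then u i else (u i)⁻¹)
      ∈ wset u N (i + 1) (W * (1 + r * C / N i)) := by
  obtain ⟨w, hw, hW, rfl⟩ := hg
  have hpos : 0 ≤ 1 + r * C / N i := by have := hN i; positivity
  refine wset_mono u N _ (mul_le_mul_of_nonneg_right hW hpos) ?_
  clear hW
  induction w with
  | nil => exact ⟨[], by simp, by simp [wt], by cases a <;> simp [evalW]⟩
  | cons p w ih =>
    have h1 := conj_letter u N hN hC h i p.1 (hw p (by simp)) a p.2
    have h2 := ih (fun q hq => hw q (by simp [hq]))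
    have h3 := wset_mul u N _ h1 h2
    rw [wt_cons, add_mul, evalW_cons]
    convert h3 using 1
    group

theorem conj_letter_pow (u : Fin r → G) (N : Fin r → ℝ) (hN : ∀ i, 0 < N i) {C : ℝ} (hC : 1 ≤ C)
    (h : UpTri u N C) (i : Fin r) (m : ℕ) (s : Bool) {W : ℝ} {g : G}
    (hg : g ∈ wset u N (i + 1) W) :
    ((if s then u i else (u i)⁻¹) ^ m)⁻¹ * g * (if s then u i else (u i)⁻¹) ^ m
      ∈ wset u N (i + 1) (W * (1 + r * C / N i) ^ m) := by
  induction m with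
  | zero => simpa using hg
  | succ m ih =>
    have := conj_word u N hN hC h i s ih
    rw [pow_succ (1 + r * C / N i), ← mul_assoc]
    convert this using 1
    rw [pow_succ]; group

theorem collect (u : Fin r → G) (N : Fin r → ℝ) (hN : ∀ i, 0 < N i) {C : ℝ} (hC : 1 ≤ C)
    (h : UpTri u N C) (i : Fin r) (w : List (Fin r × Bool)) (hw : ∀ p ∈ w, (i : ℕ) ≤ p.1)
    (m : ℕ) (hm : occ i w ≤ m) :
    ∃ (n : ℤ) (g : G), n.natAbs ≤ occ i w ∧
      g ∈ wset u N (i + 1) (wt N w * (1 + r * C / N i) ^ m) ∧ evalW u w = u i ^ n * g := by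
  have hge : 1 ≤ 1 + r * C / N i := by have := hN i; simp; positivity
  induction w with
  | nil => exact ⟨0, 1, by simp, ⟨[], by simp, by simp [wt], by simp [evalW]⟩, by simp [evalW]⟩
  | cons p w ih =>
    rw [occ_cons] at hm
    obtain ⟨n, g, hn, hg, e⟩ := ih (fun q hq => hw q (by simp [hq])) (by omega)
    rw [evalW_cons, wt_cons, occ_cons, e, add_mul]
    have hp0 : 0 ≤ (N p.1)⁻¹ * (1 + r * C / N i) ^ m := by
      have := hN p.1; positivity
    by_cases hp : p.1 = i
    · refine ⟨(if p.2 then 1 else -1) + n, g, ?_, wset_mono u N _ (by linarith) hg, ?_⟩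
      · rw [if_pos hp]
        split_ifs <;> omega
      · rw [hp, zpow_add, mul_assoc]
        split_ifs <;> simp
    · rw [if_neg hp] at hm ⊢
      have hlt : (i : ℕ) + 1 ≤ p.1 := by
        have h1 := hw p (by simp)
        have : (i : ℕ) ≠ p.1 := fun hh => hp (Fin.ext hh.symm)
        omega
      have hl : (if p.2 then u p.1 else (u p.1)⁻¹) ∈ wset u N (i + 1) (N p.1)⁻¹ :=
        ⟨[p], by simpa using hlt, by simp [wt], by simp [evalW]⟩
      have key : (u i ^ n)⁻¹ * (if p.2 then u p.1 else (u p.1)⁻¹) * u i ^ n ∈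
          wset u N (i + 1) ((N p.1)⁻¹ * (1 + r * C / N i) ^ n.natAbs) := by
        rcases Int.natAbs_eq n with hn' | hn'
        · have := conj_letter_pow u N hN hC h i n.natAbs true hl
          have e' : u i ^ n = u i ^ n.natAbs := by
            conv_lhs => rw [hn']
            exact zpow_natCast _ _
          rw [e']
          simpa using this
        · have := conj_letter_pow u N hN hC h i n.natAbs false hl
          have e' : u i ^ n = ((u i)⁻¹) ^ n.natAbs := by
            conv_lhs => rw [hn']
            rw [zpow_neg, zpow_natCast, inv_pow]
          rw [e']
          simpa using this
      have key2 := wset_mono u N _ (mul_le_mul_of_nonneg_left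
        (pow_le_pow_right₀ hge (show n.natAbs ≤ m by omega))
        (inv_nonneg.2 (hN p.1).le)) key
      refine ⟨n, _, by omega, wset_mul u N _ key2 hg, ?_⟩
      group

/-- The growth of weights. -/
noncomputable def growW (r : ℕ) (C : ℝ) (W : ℝ) : ℝ := W * Real.exp (r * C * W)

theorem collect' (u : Fin r → G) (N : Fin r → ℝ) (hN : ∀ i, 0 < N i) {C : ℝ} (hC : 1 ≤ C)
    (h : UpTri u N C) (i : Fin r) {W : ℝ} {g : G} (hg : g ∈ wset u N i W) :
    ∃ (n : ℤ) (g' : G), |(n : ℝ)| ≤ W * N i ∧ g' ∈ wset u N (i + 1) (growW r C W) ∧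
      g = u i ^ n * g' := by
  obtain ⟨w, hw, hW, rfl⟩ := hg
  obtain ⟨n, g', hn, hg', e⟩ := collect u N hN hC h i w hw _ le_rfl
  have hi := hN i
  have hocc : (occ i w : ℝ) ≤ W * N i := by
    rw [← div_le_iff₀ hi]
    refine le_trans ?_ hW
    rw [wt_eq_sum, div_eq_mul_inv]
    exact Finset.single_le_sum (f := fun k => (occ k w : ℝ) * (N k)⁻¹)
      (fun k _ => by have := hN k; positivity) (Finset.mem_univ i)
  have hwt0 : 0 ≤ wt N w := by
    rw [wt_eq_sum]; exact Finset.sum_nonneg fun k _ => by have := hN k; positivity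
  refine ⟨n, g', ?_, wset_mono u N _ ?_ hg', e⟩
  · refine le_trans ?_ hocc
    have : |(n : ℝ)| = (n.natAbs : ℝ) := by simp [Nat.cast_natAbs]
    rw [this]; exact_mod_cast hn
  · unfold growW
    have : (1 + r * C / N i) ^ occ i w ≤ Real.exp (r * C * W) := by
      calc (1 + r * C / N i) ^ occ i w ≤ Real.exp (r * C / N i) ^ occ i w := by
            gcongr
            have := Real.add_one_le_exp (r * C / N i)
            linarith
        _ = Real.exp (occ i w * (r * C / N i)) := by rw [Real.exp_nat_mul]
        _ ≤ _ := by
            apply Real.exp_le_exp.2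
            calc occ i w * (r * C / N i) ≤ (W * N i) * (r * C / N i) := by gcongr
              _ = _ := by field_simp
    exact mul_le_mul hW this (by positivity) (hwt0.trans hW)

theorem floor_bound (W x : ℝ) (hW : 0 ≤ W) (hx : 0 < x) :
    2 * (W * x) + 1 ≤ (2 * W + 1) * ((2 * ⌊x⌋ + 1 : ℤ) : ℝ) := by
  have h1 := Int.lt_floor_add_one x
  have h2 : (0 : ℝ) ≤ ⌊x⌋ := by exact_mod_cast Int.floor_nonneg.2 hx.le
  push_cast
  nlinarith [mul_nonneg hW h2]

theorem wset_card (r : ℕ) (C : ℝ) (hC : 1 ≤ C) (k : ℕ) :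
    ∀ W : ℝ, 0 ≤ W → ∃ B : ℝ, 0 ≤ B ∧ ∀ (G : Type u) [Group G] (u : Fin r → G) (N : Fin r → ℝ),
      (∀ i, 0 < N i) → UpTri u N C → ∀ i : ℕ, i + k = r →
      (wset u N i W).Finite ∧ ((wset u N i W).ncard : ℝ) ≤
        B * ∏ j : Fin r, (if i ≤ (j : ℕ) then ((2 * ⌊N j⌋ + 1 : ℤ) : ℝ) else 1) := by
  induction k with
  | zero =>
    intro W hW
    refine ⟨1, by norm_num, ?_⟩
    intro G _ u N hN h i hi
    have hsub : wset u N i W ⊆ {1} := by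
      rintro g ⟨w, hw, -, rfl⟩
      have : w = [] := by
        apply List.eq_nil_iff_forall_not_mem.2
        intro p hp
        have := hw p hp
        have := p.1.2
        omega
      simp [this, evalW]
    refine ⟨(Set.finite_singleton 1).subset hsub, ?_⟩
    have h1 := Set.ncard_le_ncard hsub
    rw [Set.ncard_singleton] at h1
    have : ∀ j : Fin r, ¬ i ≤ (j : ℕ) := fun j => by have := j.2; omega
    simp only [this, if_false, Finset.prod_const_one, mul_one]
    exact_mod_cast h1
  | succ k ih =>
    intro W hW
    obtain ⟨B, hB, hih⟩ := ih (growW r C W) (by unfold growW; positivity)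
    refine ⟨(2 * W + 1) * B, by positivity, ?_⟩
    intro G _ u N hN h i hi
    have hir : i < r := by omega
    obtain ⟨hfin, hcard⟩ := hih G u N hN h (i + 1) (by omega)
    set I : Fin r := ⟨i, hir⟩ with hI
    set J : Finset ℤ := Finset.Icc (-⌊W * N I⌋) ⌊W * N I⌋ with hJ
    have hi0 := hN I
    have hfl : 0 ≤ ⌊W * N I⌋ := Int.floor_nonneg.2 (by positivity)
    have hsub : wset u N i W ⊆ Set.image2 (fun (n : ℤ) g => u I ^ n * g) (J : Set ℤ)
        (wset u N (i + 1) (growW r C W)) := by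
      intro g hg
      obtain ⟨n, g', hn, hg', rfl⟩ := collect' u N hN hC h I (W := W) (g := g) hg
      refine ⟨n, ?_, g', hg', rfl⟩
      rw [abs_le] at hn
      simp only [hJ, Finset.coe_Icc, Set.mem_Icc]
      constructor
      · have : -n ≤ ⌊W * N I⌋ := Int.le_floor.2 (by push_cast; linarith)
        omega
      · exact Int.le_floor.2 hn.2
    have hfin2 := (J.finite_toSet).image2 (fun (n : ℤ) g => u I ^ n * g) hfin
    refine ⟨hfin2.subset hsub, ?_⟩
    have h1 : ((wset u N i W).ncard : ℝ) ≤ (J.card : ℝ) * (wset u N (i + 1) (growW r C W)).ncard := by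
      have e1 := Set.ncard_le_ncard hsub hfin2
      have e2 : (Set.image2 (fun (n : ℤ) g => u I ^ n * g) (J : Set ℤ)
        (wset u N (i + 1) (growW r C W))).ncard ≤ J.card * (wset u N (i + 1) (growW r C W)).ncard := by
        rw [← Set.image_uncurry_prod]
        refine (Set.ncard_image_le ((J.finite_toSet).prod hfin)).trans ?_
        rw [Set.ncard_prod, Set.ncard_coe_finset]
      exact_mod_cast e1.trans e2
    have hJc : (J.card : ℝ) ≤ (2 * W + 1) * ((2 * ⌊N I⌋ + 1 : ℤ) : ℝ) := by
      refine le_trans ?_ (floor_bound W (N I) hW hi0)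
      have : (J.card : ℤ) = 2 * ⌊W * N I⌋ + 1 := by
        rw [hJ, Int.card_Icc, Int.toNat_of_nonneg (by omega)]; ring
      have h3 : (J.card : ℝ) = 2 * ⌊W * N I⌋ + 1 := by exact_mod_cast this
      rw [h3]
      have := Int.floor_le (W * N I)
      linarith
    have hprod : ∏ j : Fin r, (if i ≤ (j : ℕ) then ((2 * ⌊N j⌋ + 1 : ℤ) : ℝ) else 1) =
        ((2 * ⌊N I⌋ + 1 : ℤ) : ℝ) *
        ∏ j : Fin r, (if i + 1 ≤ (j : ℕ) then ((2 * ⌊N j⌋ + 1 : ℤ) : ℝ) else 1) := by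
      have : ((2 * ⌊N I⌋ + 1 : ℤ) : ℝ) =
          ∏ j : Fin r, (if j = I then ((2 * ⌊N j⌋ + 1 : ℤ) : ℝ) else 1) := by
        rw [Finset.prod_ite_eq']; simp
      rw [this, ← Finset.prod_mul_distrib]
      refine Finset.prod_congr rfl fun j _ => ?_
      by_cases hj : j = I
      · subst hj; simp [hI]
      · have : (j : ℕ) ≠ i := fun hh => hj (Fin.ext hh)
        rw [if_neg hj, one_mul]
        have : i ≤ (j : ℕ) ↔ i + 1 ≤ (j : ℕ) := by omega
        simp [this]
    rw [hprod]
    calc ((wset u N i W).ncard : ℝ) ≤ _ := h1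
      _ ≤ ((2 * W + 1) * ((2 * ⌊N I⌋ + 1 : ℤ) : ℝ)) * (B * ∏ j : Fin r, (if i + 1 ≤ (j : ℕ) then ((2 * ⌊N j⌋ + 1 : ℤ) : ℝ) else 1)) := by
          have : (0 : ℝ) ≤ J.card := by positivity
          exact mul_le_mul hJc hcard (by positivity) (this.trans hJc)
      _ = _ := by ring

theorem dilate_card (r : ℕ) (C : ℝ) (hC : 1 ≤ C) (R : ℝ) (hR : 0 ≤ R) :
    ∃ B : ℝ, 0 ≤ B ∧ ∀ (G : Type u) [Group G] (u : Fin r → G) (N : Fin r → ℝ),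
      (∀ i, 0 < N i) → NilprogNormalForm u N C →
      (nilprogSet u (fun i => R * N i)).Finite ∧
      (Nat.card (nilprogSet u (fun i => R * N i)) : ℝ) ≤ B * Nat.card (nilprogSet u N) := by
  obtain ⟨B, hB, h⟩ := wset_card.{u} r C hC r (r * R) (by positivity)
  refine ⟨B * C, by positivity, ?_⟩
  intro G _ u N hN hnf
  obtain ⟨hfin, hcard⟩ := h G u N hN hnf.1 0 (by omega)
  have hsub := nilprogSet_sub_wset u N hN R
  refine ⟨hfin.subset hsub, ?_⟩
  have h1 : ((nilprogSet u (fun i => R * N i)).ncard : ℝ) ≤ (wset u N 0 (r * R)).ncard := by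
    exact_mod_cast Set.ncard_le_ncard hsub hfin
  rw [Nat.card_coe_set_eq]
  have h2 := hnf.2.2.1
  rw [inv_mul_le_iff₀ (by linarith)] at h2
  simp only [Nat.zero_le, if_true] at hcard
  calc _ ≤ _ := h1
    _ ≤ _ := hcard
    _ ≤ B * (C * Nat.card (nilprogSet u N)) := by gcongr
    _ = _ := by ring

theorem letter_zpow_mem (u : Fin r → G) (i : Fin r) (n : ℤ) :
    u i ^ n ∈ nilprogSet u (fun k => if i = k then |(n : ℝ)| else 0) := by
  rw [mem_nilprogSet_iff]
  refine ⟨List.replicate n.natAbs (i, decide (0 ≤ n)), fun k => ?_, ?_⟩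
  · have : |(n : ℝ)| = (n.natAbs : ℝ) := by simp [Nat.cast_natAbs]
    by_cases hk : i = k
    · rw [if_pos hk, this]
      have : occ k (List.replicate n.natAbs (i, decide (0 ≤ n))) ≤ n.natAbs := by
        unfold occ
        exact (List.length_filter_le _ _).trans (by simp)
      exact_mod_cast this
    · rw [if_neg hk]
      simp [occ, hk]
  · rcases Int.natAbs_eq n with hn | hn
    · have : 0 ≤ n := by omega
      simp only [evalW, List.map_replicate, List.prod_replicate, this]
      obtain ⟨k, hk⟩ := Int.eq_ofNat_of_zero_le this
      subst hk; simp
    · by_cases h0 : 0 ≤ n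
      · have : n = 0 := by omega
        simp [this, evalW]
      · simp only [evalW, List.map_replicate, List.prod_replicate, h0]
        generalize n.natAbs = k at hn
        subst hn; simp

theorem letters_prod_mem (u : Fin r → G) (n : Fin r → ℤ) (l : List (Fin r)) :
    (l.map fun i => u i ^ n i).prod ∈
      nilprogSet u (fun k => (l.map fun i => if i = k then |(n i : ℝ)| else 0).sum) := by
  induction l with
  | nil => simpa using nilprogSet_one u (N := fun _ => 0) (by simp)
  | cons i l ih =>
    simp only [List.map_cons, List.prod_cons, List.sum_cons]
    exact nilprogSet_mul u (letter_zpow_mem u i (n i)) ih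

theorem ofFn_prod_mem (u : Fin r → G) (n : Fin r → ℤ) :
    (List.ofFn fun i => u i ^ n i).prod ∈ nilprogSet u (fun k => |(n k : ℝ)|) := by
  have := letters_prod_mem u n (List.finRange r)
  rw [List.ofFn_eq_map]
  refine nilprogSet_mono u (fun k => le_of_eq ?_) this
  rw [← List.ofFn_eq_map, List.sum_ofFn]
  simp

theorem half_card (u : Fin r → G) (N : Fin r → ℝ) (hN : ∀ i, 0 < N i) (C : ℝ) (hC : 1 ≤ C)
    (h : NilprogNormalForm u N C) (hfin : (nilprogSet u (fun i => (1 / 2 : ℝ) * N i)).Finite) :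
    (Nat.card (nilprogSet u N) : ℝ) ≤
      C * (4 * C + 1) ^ r * Nat.card (nilprogSet u (fun i => (1 / 2 : ℝ) * N i)) := by
  classical
  set f : Fin r → ℤ := fun i => ⌊N i / (2 * C)⌋ with hf
  have hf0 : ∀ i, 0 ≤ f i := fun i => Int.floor_nonneg.2 (by have := hN i; positivity)
  set B : Finset (Fin r → ℤ) := Fintype.piFinset fun i => Finset.Icc (-(f i)) (f i) with hB
  have hBm : ∀ n ∈ B, ∀ i, |(n i : ℝ)| ≤ N i / (2 * C) := by
    intro n hn i
    have := Fintype.mem_piFinset.1 hn i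
    rw [Finset.mem_Icc] at this
    have h1 : |n i| ≤ f i := abs_le.2 this
    have h2 : ((|n i| : ℤ) : ℝ) ≤ f i := by exact_mod_cast h1
    rw [Int.cast_abs] at h2
    exact h2.trans (Int.floor_le _)
  have hle : ∀ i, N i / (2 * C) ≤ N i / C := fun i => by
    have := hN i
    gcongr; linarith
  have hle2 : ∀ i, N i / (2 * C) ≤ 1 / 2 * N i := fun i => by
    have := hN i
    rw [div_le_iff₀ (by positivity)]; nlinarith
  have hcard : B.card ≤ (nilprogSet u (fun i => (1 / 2 : ℝ) * N i)).ncard := by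
    rw [← Set.ncard_coe_finset]
    refine Set.ncard_le_ncard_of_injOn (fun n => (List.ofFn fun i => u i ^ n i).prod) ?_ ?_ hfin
    · intro n hn
      exact nilprogSet_mono u (fun k => (hBm n hn k).trans (hle2 k)) (ofFn_prod_mem u n)
    · intro n hn n' hn' e
      exact h.2.1 n n' (fun i => (hBm n hn i).trans (hle i))
        (fun i => (hBm n' hn' i).trans (hle i)) e
  have hBc : (B.card : ℝ) = ∏ i, ((2 * f i + 1 : ℤ) : ℝ) := by
    rw [hB, Fintype.card_piFinset]
    push_cast
    refine Finset.prod_congr rfl fun i _ => ?_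
    have : ((Finset.Icc (-(f i)) (f i)).card : ℤ) = 2 * f i + 1 := by
      rw [Int.card_Icc, Int.toNat_of_nonneg (by have := hf0 i; omega)]; ring
    have h2 : (((Finset.Icc (-(f i)) (f i)).card : ℤ) : ℝ) = ((2 * f i + 1 : ℤ) : ℝ) := by
      rw [this]
    push_cast at h2
    exact h2
  have hprod : ∏ i, ((2 * ⌊N i⌋ + 1 : ℤ) : ℝ) ≤ (4 * C + 1) ^ r * B.card := by
    rw [hBc]
    have : (4 * C + 1) ^ r = ∏ i : Fin r, (4 * C + 1) := by simp
    rw [this, ← Finset.prod_mul_distrib]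
    refine Finset.prod_le_prod (fun i _ => ?_) fun i _ => ?_
    · have : 0 ≤ ⌊N i⌋ := Int.floor_nonneg.2 (hN i).le
      exact_mod_cast (by omega : (0 : ℤ) ≤ 2 * ⌊N i⌋ + 1)
    · have h1 := floor_bound (2 * C) (N i / (2 * C)) (by linarith) (by have := hN i; positivity)
      have h2 : 2 * C * (N i / (2 * C)) = N i := by field_simp
      rw [h2] at h1
      have h3 := Int.floor_le (N i)
      have h4 : 2 * (2 * C) + 1 = 4 * C + 1 := by ring
      rw [h4] at h1
      refine le_trans ?_ h1
      push_cast; linarith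
  rw [Nat.card_coe_set_eq (nilprogSet u (fun i => (1 / 2 : ℝ) * N i))]
  calc _ ≤ _ := h.2.2.2
    _ ≤ C * ((4 * C + 1) ^ r * B.card) := by gcongr
    _ ≤ C * ((4 * C + 1) ^ r * ((nilprogSet u (fun i => (1 / 2 : ℝ) * N i)).ncard : ℝ)) := by
        gcongr
    _ = _ := by ring

end nil

section coset

variable {G : Type u} [Group G] (Q : CosetNilprog G)

theorem setT_mono {s t : ℝ} (h : s ≤ t) : Q.setT s ⊆ Q.setT t := by
  rintro g ⟨hg, hm⟩
  exact ⟨hg, nilprogSet_mono _ (fun i => mul_le_mul_of_nonneg_right h (Q.N_pos i).le) hm⟩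

theorem setT_mul {s t : ℝ} {g h : G} (hg : g ∈ Q.setT s) (hh : h ∈ Q.setT t) :
    g * h ∈ Q.setT (s + t) := by
  obtain ⟨hg1, hg2⟩ := hg
  obtain ⟨hh1, hh2⟩ := hh
  refine ⟨mul_mem hg1 hh1, ?_⟩
  have := nilprogSet_mul _ hg2 hh2
  refine nilprogSet_mono _ (fun i => le_of_eq (by ring)) this

theorem setT_inv {s : ℝ} {g : G} (hg : g ∈ Q.setT s) : g⁻¹ ∈ Q.setT s := by
  obtain ⟨hg1, hg2⟩ := hg
  exact ⟨inv_mem hg1, nilprogSet_inv _ hg2⟩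

theorem setT_one {s : ℝ} (hs : 0 ≤ s) : (1 : G) ∈ Q.setT s :=
  ⟨one_mem _, nilprogSet_one _ fun i => mul_nonneg hs (Q.N_pos i).le⟩

theorem card_setT (t : ℝ) :
    Nat.card (Q.setT t) = Nat.card Q.H * Nat.card (nilprogSet Q.vbar fun i => t * Q.N i) := by
  set Nm := Subgroup.normalizer (Q.H : Set G)
  have e1 : Q.setT t = Subtype.val '' ((QuotientGroup.mk : Nm → Q.Qt) ⁻¹'
      (nilprogSet Q.vbar fun i => t * Q.N i)) := by
    ext g
    constructor
    · rintro ⟨hg, hm⟩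
      exact ⟨⟨g, hg⟩, hm, rfl⟩
    · rintro ⟨⟨g, hg⟩, hm, rfl⟩
      exact ⟨hg, hm⟩
  rw [e1, Nat.card_image_of_injective Subtype.val_injective,
    Nat.card_congr (QuotientGroup.preimageMkEquivSubgroupProdSet _ _), Nat.card_prod]
  congr 1
  exact Nat.card_congr (Subgroup.subgroupOfEquivOfLe Subgroup.le_normalizer).toEquiv

theorem finite_setT (t : ℝ) (h : (nilprogSet Q.vbar fun i => t * Q.N i).Finite) :
    (Q.setT t).Finite := by
  by_cases ht : (Q.setT t).Nonempty
  · have hne : (nilprogSet Q.vbar fun i => t * Q.N i).Nonempty := by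
      obtain ⟨g, hg, hm⟩ := ht
      exact ⟨_, hm⟩
    have := card_setT Q t
    have h1 : 0 < Nat.card Q.H := by
      have : Finite Q.H := Q.Hfin
      exact Nat.card_pos
    have h2 : 0 < Nat.card (nilprogSet Q.vbar fun i => t * Q.N i) := by
      have := h.to_subtype
      have := hne.to_subtype
      exact Nat.card_pos
    have h3 : 0 < Nat.card (Q.setT t) := by rw [this]; positivity
    exact (Nat.card_pos_iff.1 h3).2
  · rw [Set.not_nonempty_iff_eq_empty.1 ht]; exact Set.finite_empty

theorem nnorm_le {t : ℝ} (ht : 0 < t) {g : G} (hg : g ∈ Q.setT t) : Q.nnorm g ≤ ENNReal.ofReal t :=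
  sInf_le ⟨t, ⟨ht, hg⟩, rfl⟩

theorem mem_of_nnorm_lt {t : ℝ} {g : G} (h : Q.nnorm g < ENNReal.ofReal t) : g ∈ Q.setT t := by
  obtain ⟨_, ⟨s, ⟨hs, hg⟩, rfl⟩, hlt⟩ := sInf_lt_iff.1 h
  exact setT_mono Q ((ENNReal.ofReal_lt_ofReal_iff_of_nonneg hs.le).1 hlt).le hg

theorem nnorm_mul (g h : G) : Q.nnorm (g * h) ≤ Q.nnorm g + Q.nnorm h := by
  unfold CosetNilprog.nnorm
  rw [sInf_eq_iInf (s := ENNReal.ofReal '' { t : ℝ | 0 < t ∧ g ∈ Q.setT t }),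
    sInf_eq_iInf (s := ENNReal.ofReal '' { t : ℝ | 0 < t ∧ h ∈ Q.setT t })]
  refine ENNReal.le_of_forall_pos_le_add fun ε hε hfin => ?_
  have key : ∀ k : G, ∀ a, sInf (ENNReal.ofReal '' { t : ℝ | 0 < t ∧ k ∈ Q.setT t }) < a →
      ∃ t, 0 < t ∧ k ∈ Q.setT t ∧ ENNReal.ofReal t < a := by
    intro k a hk
    obtain ⟨_, ⟨s, ⟨hs, hg⟩, rfl⟩, hlt⟩ := sInf_lt_iff.1 hk
    exact ⟨s, hs, hg, hlt⟩
  rw [← sInf_eq_iInf, ← sInf_eq_iInf] at hfin ⊢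
  obtain ⟨hf1, hf2⟩ := ENNReal.add_lt_top.1 hfin
  have hε2 : ((ε / 2 : NNReal) : ℝ≥0∞) ≠ 0 := by
    have : ε / 2 ≠ 0 := by positivity
    exact_mod_cast this
  obtain ⟨s, hs, hsg, hs2⟩ := key g _ (ENNReal.lt_add_right hf1.ne hε2)
  obtain ⟨t, ht, htg, ht2⟩ := key h _ (ENNReal.lt_add_right hf2.ne hε2)
  calc _ ≤ ENNReal.ofReal (s + t) := nnorm_le Q (by positivity) (setT_mul Q hsg htg)
    _ = ENNReal.ofReal s + ENNReal.ofReal t := ENNReal.ofReal_add hs.le ht.le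
    _ ≤ _ := add_le_add hs2.le ht2.le
    _ = _ := by
      rw [add_add_add_comm, ← ENNReal.coe_add, add_halves]

theorem nnorm_inv (g : G) : Q.nnorm g⁻¹ = Q.nnorm g := by
  unfold CosetNilprog.nnorm
  have : { t : ℝ | 0 < t ∧ g⁻¹ ∈ Q.setT t } = { t : ℝ | 0 < t ∧ g ∈ Q.setT t } := by
    ext t
    exact ⟨fun h => ⟨h.1, by simpa using setT_inv Q h.2⟩, fun h => ⟨h.1, setT_inv Q h.2⟩⟩
  rw [this]

theorem nnorm_one : Q.nnorm 1 = 0 := by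
  refine le_antisymm (ENNReal.le_of_forall_pos_le_add fun ε hε _ => ?_) zero_le
  have := nnorm_le Q (t := ε) (by exact_mod_cast hε) (setT_one Q (by positivity))
  simpa using this

/-- Distance to `X`. -/
noncomputable def phi (X : Finset G) (y : G) : ℝ≥0∞ :=
  ⨅ x : { x // x ∈ X }, Q.nnorm ((x : G)⁻¹ * y)

theorem phi_mul_le (X : Finset G) (g y : G) : phi Q X (g * y) ≤ phi Q X y + Q.snorm X g := by
  unfold CosetNilprog.snorm
  rw [ENNReal.add_iInf]
  refine le_iInf fun σ => ?_
  nth_rewrite 2 [phi]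
  rw [ENNReal.iInf_add]
  refine le_iInf fun x => ?_
  calc phi Q X (g * y) ≤ Q.nnorm ((σ x : G)⁻¹ * (g * y)) := iInf_le _ (σ x)
    _ = Q.nnorm (((σ x : G)⁻¹ * g * x) * ((x : G)⁻¹ * y)) := by congr 1; group
    _ ≤ _ := nnorm_mul Q _ _
    _ ≤ _ := by
      rw [add_comm]
      gcongr
      exact le_iSup (fun x : { x // x ∈ X } => Q.nnorm ((σ x : G)⁻¹ * g * (x : G))) x

theorem phi_le_mul (X : Finset G) (g y : G) : phi Q X y ≤ phi Q X (g * y) + Q.snorm X g := by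
  unfold CosetNilprog.snorm
  rw [ENNReal.add_iInf]
  refine le_iInf fun σ => ?_
  nth_rewrite 2 [phi]
  rw [ENNReal.iInf_add]
  refine le_iInf fun x' => ?_
  obtain ⟨x, rfl⟩ := σ.surjective x'
  calc phi Q X y ≤ Q.nnorm ((x : G)⁻¹ * y) := iInf_le _ x
    _ = Q.nnorm (((σ x : G)⁻¹ * g * x)⁻¹ * ((σ x : G)⁻¹ * (g * y))) := by congr 1; group
    _ ≤ _ := nnorm_mul Q _ _
    _ ≤ _ := by
      rw [add_comm, nnorm_inv]
      gcongr
      exact le_iSup (fun x : { x // x ∈ X } => Q.nnorm ((σ x : G)⁻¹ * g * (x : G))) x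

theorem phi_lt (X : Finset G) (y : G) {t : ℝ} (h : phi Q X y < ENNReal.ofReal t) :
    y ∈ (X : Set G) * Q.setT t := by
  obtain ⟨x, hx⟩ := iInf_lt_iff.1 h
  exact ⟨x, x.2, _, mem_of_nnorm_lt Q hx, by group⟩

/-- Lipschitz in the truncated form. -/
theorem tsub_lip (a b d : ℝ≥0∞) (h : b ≤ a + d) : 1 - a ≤ 1 - b + d := by
  rw [tsub_le_iff_right]
  calc 1 ≤ 1 - b + b := le_tsub_add
    _ ≤ 1 - b + (a + d) := by gcongr
    _ = _ := by ring

end coset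

section conv

variable {G : Type u} [Group G] [DecidableEq G]

theorem mconvPow_props (μ : G → ℝ) (h0 : ∀ x, 0 ≤ μ x) (h1 : ∑' x, μ x = 1) (n : ℕ) :
    (∀ x, 0 ≤ mconvPow μ n x) ∧ (∑' x, ENNReal.ofReal (mconvPow μ n x) = 1) ∧
    (∀ x, mconvPow μ n x ≤ 1) := by
  have hsum : Summable μ := by
    by_contra h
    rw [tsum_eq_zero_of_not_summable h] at h1
    norm_num at h1
  induction n with
  | zero =>
    refine ⟨fun x => ?_, ?_, fun x => ?_⟩
    · simp only [mconvPow]; split_ifs <;> norm_num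
    · rw [tsum_eq_single 1]
      · simp [mconvPow]
      · intro b hb; simp [mconvPow, hb]
    · simp only [mconvPow]; split_ifs <;> norm_num
  | succ n ih =>
    obtain ⟨ih1, ih2, ih3⟩ := ih
    have hs : ∀ x, Summable fun y => μ y * mconvPow μ n (y⁻¹ * x) := fun x =>
      Summable.of_nonneg_of_le (fun y => mul_nonneg (h0 _) (ih1 _))
        (fun y => mul_le_of_le_one_right (h0 _) (ih3 _)) hsum
    refine ⟨fun x => tsum_nonneg fun y => mul_nonneg (h0 _) (ih1 _), ?_, fun x => ?_⟩
    · have e : ∀ x, ENNReal.ofReal (mconvPow μ (n + 1) x) =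
          ∑' y, ENNReal.ofReal (μ y) * ENNReal.ofReal (mconvPow μ n (y⁻¹ * x)) := by
        intro x
        show ENNReal.ofReal (∑' y, μ y * mconvPow μ n (y⁻¹ * x)) = _
        rw [ENNReal.ofReal_tsum_of_nonneg (fun y => mul_nonneg (h0 _) (ih1 _)) (hs x)]
        simp_rw [ENNReal.ofReal_mul (h0 _)]
      simp_rw [e]
      rw [ENNReal.tsum_comm]
      simp_rw [ENNReal.tsum_mul_left]
      have : ∀ y : G, ∑' x, ENNReal.ofReal (mconvPow μ n (y⁻¹ * x)) = 1 := fun y => by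
        rw [tsum_translate (fun x => ENNReal.ofReal (mconvPow μ n x)), ih2]
      simp_rw [this, mul_one]
      rw [← ENNReal.ofReal_tsum_of_nonneg h0 hsum, h1, ENNReal.ofReal_one]
    · show ∑' y, μ y * mconvPow μ n (y⁻¹ * x) ≤ 1
      rw [← h1]
      exact (hs x).tsum_le_tsum (fun y => mul_le_of_le_one_right (h0 _) (ih3 _)) hsum

theorem mconvPow_succ_ofReal (μ : G → ℝ) (h0 : ∀ x, 0 ≤ μ x) (h1 : ∑' x, μ x = 1) (n : ℕ) :
    (fun x => ENNReal.ofReal (mconvPow μ (n + 1) x)) =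
      econv (fun x => ENNReal.ofReal (μ x)) (fun x => ENNReal.ofReal (mconvPow μ n x)) := by
  have hsum : Summable μ := by
    by_contra h
    rw [tsum_eq_zero_of_not_summable h] at h1
    norm_num at h1
  obtain ⟨ih1, ih2, ih3⟩ := mconvPow_props μ h0 h1 n
  funext x
  have hs : Summable fun y => μ y * mconvPow μ n (y⁻¹ * x) :=
      Summable.of_nonneg_of_le (fun y => mul_nonneg (h0 _) (ih1 _))
        (fun y => mul_le_of_le_one_right (h0 _) (ih3 _)) hsum
  show ENNReal.ofReal (∑' y, μ y * mconvPow μ n (y⁻¹ * x)) = _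
  rw [ENNReal.ofReal_tsum_of_nonneg (fun y => mul_nonneg (h0 _) (ih1 _)) hs]
  simp_rw [ENNReal.ofReal_mul (h0 _)]
  rfl

theorem mconvPow_sq (μ : G → ℝ) (h0 : ∀ x, 0 ≤ μ x) (h1 : ∑' x, μ x = 1) (n : ℕ) :
    (∑' x, ENNReal.ofReal (mconvPow μ n x) ^ 2 ≤ 1) ∧
    (∑' x, ENNReal.ofReal (mconvPow μ n x) ^ 2).toReal = ∑' x, mconvPow μ n x ^ 2 := by
  obtain ⟨ih1, ih2, ih3⟩ := mconvPow_props μ h0 h1 n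
  constructor
  · rw [← ih2]
    refine ENNReal.tsum_le_tsum fun x => ?_
    rw [sq]
    exact mul_le_of_le_one_right' (by simpa using ih3 x)
  · rw [ENNReal.tsum_toReal_eq (fun x => by simp)]
    refine tsum_congr fun x => ?_
    rw [ENNReal.toReal_pow, ENNReal.toReal_ofReal (ih1 x)]

end conv

set_option maxHeartbeats 1000000 in
theorem direct_fixed_rank (r : ℕ) (M : ℝ) (hM : 1 ≤ M) :
    ∃ C : ℝ, 0 ≤ C ∧ ∀ (G : Type u) [Group G] [DecidableEq G] (μ : G → ℝ) (Q : CosetNilprog G)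
      (X : Finset G) (n : ℕ), Q.r = r →
      (∀ x, 0 ≤ μ x) → (∑' x, μ x) = 1 → (∀ x, μ x⁻¹ = μ x) →
      Q.InNormalForm M → X.Nonempty → (X.card : ℝ) ≤ M → 1 ≤ n →
      (∑' g : G, Q.snorm X g ^ 2 * ENNReal.ofReal (μ g)) ≤ ENNReal.ofReal (M / (n : ℝ)) →
      (∑' x, mconvPow μ n x ^ 2)⁻¹ ≤ C * (Nat.card Q.carrier : ℝ) := by
  -- constants
  set c0 : ℝ := M * (4 * M + 1) ^ r with hc0
  have hc0p : 0 < c0 := by positivity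
  set K : ℝ := 4 * M * M * c0 with hK
  have hKp : 0 < K := by positivity
  set R : ℝ := 2 * K * (2 * M) + 1 with hR
  have hRp : 0 < R := by positivity
  obtain ⟨B, hB, hdil⟩ := dilate_card.{u} r M hM R hRp.le
  obtain ⟨B1, hB1, hdil1⟩ := dilate_card.{u} r M hM 1 (by norm_num)
  set C1 : ℝ := Real.exp (4 * K) * (4 * c0) * M ^ 2 with hC1
  set C2 : ℝ := 4 ^ (⌈2 * K⌉₊) * (M * B) with hC2
  refine ⟨C1 + C2, by positivity, ?_⟩
  intro G _ _ μ Q X n hr hμ0 hμ1 hμs hnf hXne hXM hn hsum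
  subst hr
  set m : G → ℝ≥0∞ := fun x => ENNReal.ofReal (μ x) with hm
  set ν : ℕ → G → ℝ≥0∞ := fun k x => ENNReal.ofReal (mconvPow μ k x) with hν
  have hνs : ∀ k, ν (k + 1) = econv m (ν k) := fun k => mconvPow_succ_ofReal μ hμ0 hμ1 k
  have hν1 : ∀ k, ∑' x, ν k x ^ 2 ≤ 1 := fun k => (mconvPow_sq μ hμ0 hμ1 k).1
  have hms : ∀ x, m x⁻¹ = m x := fun x => by simp [hm, hμs]
  have hsumμ : Summable μ := by
    by_contra h
    rw [tsum_eq_zero_of_not_summable h] at hμ1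
    norm_num at hμ1
  have hm1 : ∑' x, m x = 1 := by
    rw [hm, ← ENNReal.ofReal_tsum_of_nonneg hμ0 hsumμ, hμ1, ENNReal.ofReal_one]
  rw [← (mconvPow_sq μ hμ0 hμ1 n).2]
  change (∑' x, ν n x ^ 2).toReal⁻¹ ≤ _
  -- cardinalities
  obtain ⟨hfR, hcR⟩ := hdil Q.Qt Q.vbar Q.N Q.N_pos hnf
  obtain ⟨hf1, -⟩ := hdil1 Q.Qt Q.vbar Q.N Q.N_pos hnf
  have hTR := finite_setT Q R hfR
  have hT1 := finite_setT Q 1 hf1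
  have hfh : (nilprogSet Q.vbar fun i => (1 / 2 : ℝ) * Q.N i).Finite :=
    hf1.subset (nilprogSet_mono _ fun i => by have := Q.N_pos i; linarith)
  have hTh := finite_setT Q (1 / 2) hfh
  have hch := half_card Q.vbar Q.N Q.N_pos M hM hnf hfh
  have hP1 : (nilprogSet Q.vbar fun i => (1 : ℝ) * Q.N i) = nilprogSet Q.vbar Q.N := by simp
  set p : ℝ := (Nat.card Q.carrier : ℝ) with hp
  have hpeq : p = Nat.card Q.H * Nat.card (nilprogSet Q.vbar Q.N) := by
    rw [hp, CosetNilprog.carrier, card_setT, hP1]; push_cast; ring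
  have hpR : (Nat.card (Q.setT R) : ℝ) ≤ B * p := by
    rw [hpeq, card_setT]; push_cast
    calc _ ≤ (Nat.card Q.H : ℝ) * (B * Nat.card (nilprogSet Q.vbar Q.N)) := by gcongr
      _ = _ := by ring
  have hph : p ≤ c0 * Nat.card (Q.setT (1 / 2)) := by
    rw [hpeq, card_setT]; push_cast
    calc _ ≤ (Nat.card Q.H : ℝ) * (c0 * Nat.card (nilprogSet Q.vbar fun i => (1 / 2 : ℝ) * Q.N i)) := by gcongr
      _ = _ := by push_cast; ring
  have hpp : 0 < p := by
    rw [hp]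
    have : 0 < Nat.card Q.carrier := by
      have : Finite Q.carrier := hT1
      have : Nonempty Q.carrier := ⟨⟨1, setT_one Q (by norm_num)⟩⟩
      exact Nat.card_pos
    exact_mod_cast this
  have hXcard : ∀ t (ht : (Q.setT t).Finite),
      ((X * ht.toFinset).card : ℝ) ≤ M * Nat.card (Q.setT t) := by
    intro t ht
    have h1 : (X * ht.toFinset).card ≤ X.card * ht.toFinset.card := Finset.card_mul_le
    have h2 : ht.toFinset.card = Nat.card (Q.setT t) := by
      rw [Nat.card_coe_set_eq, Set.ncard_eq_toFinset_card _ ht]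
    rw [h2] at h1
    have h3 : ((X * ht.toFinset).card : ℝ) ≤ X.card * Nat.card (Q.setT t) := by exact_mod_cast h1
    exact h3.trans (by gcongr)
  obtain ⟨x0, hx0⟩ := hXne
  have hn0 : (0 : ℝ) < n := by exact_mod_cast hn
  by_cases hcase : 2 * K ≤ n
  · -- large n
    set f : G → ℝ≥0∞ := fun y => 1 - phi Q X y with hf
    set S : Finset G := X * hT1.toFinset with hS
    have hSp : (S.card : ℝ) ≤ M * p := hXcard 1 hT1
    have hEf : ENNReal.ofReal (p / (4 * c0)) ≤ ∑' x, f x ^ 2 := by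
      classical
      set U : Finset G := hTh.toFinset.image (fun y => x0 * y) with hU
      have hUc : U.card = Nat.card (Q.setT (1 / 2)) := by
        rw [hU, Finset.card_image_of_injective _ (mul_right_injective x0),
          Nat.card_coe_set_eq, Set.ncard_eq_toFinset_card _ hTh]
      have hfU : ∀ y ∈ U, ENNReal.ofReal (1 / 2) ≤ f y := by
        intro y hy
        obtain ⟨z, hz, rfl⟩ := Finset.mem_image.1 hy
        have hz' : z ∈ Q.setT (1 / 2) := by simpa using hz
        have h1 : phi Q X (x0 * z) ≤ ENNReal.ofReal (1 / 2) := by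
          refine (iInf_le _ ⟨x0, hx0⟩).trans ?_
          simpa using nnorm_le Q (by norm_num) hz'
        calc ENNReal.ofReal (1 / 2) = 1 - ENNReal.ofReal (1 / 2) := by
              rw [← ENNReal.ofReal_one, ← ENNReal.ofReal_sub _ (by norm_num)]; norm_num
          _ ≤ _ := by simp only [hf]; gcongr
      calc ENNReal.ofReal (p / (4 * c0)) ≤ ENNReal.ofReal (U.card * (1 / 2) ^ 2) := by
            apply ENNReal.ofReal_le_ofReal
            rw [hUc, div_le_iff₀ (by positivity)]
            linarith
        _ = ∑ y ∈ U, ENNReal.ofReal (1 / 2) ^ 2 := by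
            rw [ENNReal.ofReal_mul (by positivity), ENNReal.ofReal_pow (by norm_num)]
            simp
        _ ≤ ∑ y ∈ U, f y ^ 2 := Finset.sum_le_sum fun y hy => by gcongr; exact hfU y hy
        _ ≤ _ := ENNReal.sum_le_tsum U
    have h0 : econv (ν 0) f = f := by
      funext x
      unfold econv
      rw [tsum_eq_single 1]
      · simp [hν, mconvPow]
      · intro b hb; simp [hν, mconvPow, hb]
    have hmain := spectral_bound m f (Q.snorm X) hm1 hms ν h0 hνs hν1 S
      (fun x => tsub_le_self) (fun x hx => by
        by_contra hne
        apply hx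
        have h2 : phi Q X x < ENNReal.ofReal 1 := by
          rw [ENNReal.ofReal_one]
          by_contra hcon
          exact hne (tsub_eq_zero_of_le (not_lt.1 hcon))
        have := phi_lt Q X x h2
        rw [hS, ← Finset.mem_coe, Finset.coe_mul]
        simpa using this)
      (fun g x => tsub_lip _ _ _ (phi_le_mul Q X g x))
      (fun g x => tsub_lip _ _ _ (phi_mul_le Q X g x))
      n M K (p / (4 * c0)) (by linarith) hn (by positivity) hsum hEf
      (by
        have : K * (p / (4 * c0)) = M * (M * p) := by rw [hK]; field_simp
        rw [this]; gcongr) hcase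
    set q := (∑' x, ν n x ^ 2).toReal with hq
    have hq0 : 0 ≤ q := ENNReal.toReal_nonneg
    have h5 : Real.exp (-(4 * K)) * (p / (4 * c0)) ≤ q * (M * p) ^ 2 := hmain.trans (by gcongr)
    have h6 : 1 ≤ q * (C1 * p) := by
      rw [Real.exp_neg] at h5
      have h7 : p * 1 ≤ p * (q * (C1 * p)) := by
        calc p * 1 = (Real.exp (4 * K) * (4 * c0)) * ((Real.exp (4 * K))⁻¹ * (p / (4 * c0))) := by
              field_simp
          _ ≤ (Real.exp (4 * K) * (4 * c0)) * (q * (M * p) ^ 2) := by gcongr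
          _ = _ := by rw [hC1]; ring
      exact le_of_mul_le_mul_left h7 hpp
    have hqp : 0 < q := by
      rcases hq0.lt_or_eq with h | h
      · exact h
      · rw [← h] at h6; norm_num at h6
    rw [inv_le_iff_one_le_mul₀ hqp]
    have hrest : 0 ≤ q * (C2 * p) := by positivity
    have hexpand : (C1 + C2) * p * q = q * (C1 * p) + q * (C2 * p) := by ring
    rw [hexpand]
    linarith only [h6, hrest]
  · -- small n
    push Not at hcase
    set L : ℝ := 2 * M with hL
    set A : Set G := {g | Q.snorm X g ≤ ENNReal.ofReal L} with hA
    set D : ℕ → Set G := fun k => {y | phi Q X (y * x0) ≤ ENNReal.ofReal (k * L)} with hD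
    have hAm : (2⁻¹ : ℝ≥0∞) ≤ ∑' g, A.indicator m g := by
      have h1 : ∑' g, Aᶜ.indicator m g ≤ 2⁻¹ := by
        have h2 : ENNReal.ofReal (L ^ 2) * ∑' g, Aᶜ.indicator m g ≤ ENNReal.ofReal M := by
          rw [← ENNReal.tsum_mul_left]
          calc _ ≤ ∑' g, Q.snorm X g ^ 2 * m g := by
                refine ENNReal.tsum_le_tsum fun g => ?_
                by_cases hg : g ∈ A
                · simp [hg]
                · rw [Set.indicator_of_mem (by exact hg), ENNReal.ofReal_pow (by positivity)]
                  gcongr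
                  exact (not_le.1 hg).le
            _ ≤ _ := hsum
            _ ≤ _ := by
              apply ENNReal.ofReal_le_ofReal
              apply div_le_self (by linarith)
              exact_mod_cast hn
        have h3 : ENNReal.ofReal (2 * M) * ∑' g, Aᶜ.indicator m g ≤ ENNReal.ofReal (2 * M) * 2⁻¹ := by
          calc _ ≤ ENNReal.ofReal (L ^ 2) * ∑' g, Aᶜ.indicator m g := by
                gcongr; rw [hL]; nlinarith
            _ ≤ _ := h2
            _ = _ := by
              rw [mul_comm 2 M, ENNReal.ofReal_mul (by linarith), mul_assoc]
              simp [ENNReal.mul_inv_cancel]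
        exact (ENNReal.mul_le_mul_iff_right (by simp; linarith)
          ENNReal.ofReal_ne_top).1 h3
      have h4 : ∑' g, A.indicator m g + ∑' g, Aᶜ.indicator m g = 1 := by
        rw [← ENNReal.tsum_add, ← hm1]
        refine tsum_congr fun g => ?_
        exact Set.indicator_self_add_compl_apply A m g
      have h5 : (1 : ℝ≥0∞) ≤ ∑' g, A.indicator m g + 2⁻¹ := by rw [← h4]; gcongr
      have h6 := tsub_le_iff_right.2 h5
      rwa [ENNReal.one_sub_inv_two] at h6
    have hD0 : (1 : ℝ≥0∞) ≤ ∑' g, (D 0).indicator (ν 0) g := by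
      refine le_trans ?_ (ENNReal.le_tsum 1)
      have : (1 : G) ∈ D 0 := by
        simp only [hD, Set.mem_ofPred_eq, one_mul]
        refine (iInf_le _ ⟨x0, hx0⟩).trans ?_
        simp [nnorm_one]
      rw [Set.indicator_of_mem this]
      simp [hν, mconvPow]
    have hDs : ∀ k, ∀ g ∈ A, ∀ y ∈ D k, g * y ∈ D (k + 1) := by
      intro k g hg y hy
      simp only [hD, Set.mem_ofPred_eq] at hy ⊢
      rw [mul_assoc]
      refine (phi_mul_le Q X g _).trans ?_
      have : ((k + 1 : ℕ) : ℝ) * L = k * L + L := by push_cast; ring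
      rw [this, ENNReal.ofReal_add (by positivity) (by positivity)]
      exact add_le_add hy hg
    have hmass := mass_bound m ν hνs A D _ hAm hD0 hDs n
    classical
    set S : Finset G := (X * hTR.toFinset).image (fun y => y * x0⁻¹) with hS
    have hDS : D n ⊆ S := by
      intro y hy
      have h1 : phi Q X (y * x0) < ENNReal.ofReal R := by
        refine lt_of_le_of_lt hy ?_
        rw [ENNReal.ofReal_lt_ofReal_iff hRp, hR]
        have : (n : ℝ) * L ≤ 2 * K * L := by gcongr
        rw [hL] at this ⊢
        linarith
      have h2 := phi_lt Q X _ h1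
      simp only [hS, Finset.coe_image, Finset.coe_mul, Set.Finite.coe_toFinset]
      exact ⟨_, h2, by group⟩
    have hSc : (S.card : ℝ) ≤ M * (B * p) := by
      have h1 : (S.card : ℝ) ≤ (X * hTR.toFinset).card := by
        exact_mod_cast Finset.card_image_le
      exact h1.trans ((hXcard R hTR).trans (by gcongr))
    have h7 := mass_cs (ν n) (D n) S hDS _ hmass
    have h8 := ENNReal.toReal_mono (ENNReal.mul_ne_top
        (ne_top_of_le_ne_top ENNReal.one_ne_top (hν1 n)) (by simp)) h7
    set q := (∑' x, ν n x ^ 2).toReal with hq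
    have hq0 : 0 ≤ q := ENNReal.toReal_nonneg
    rw [ENNReal.toReal_mul, ENNReal.toReal_natCast, ← hq] at h8
    have h9 : ((4 : ℝ) ^ n)⁻¹ ≤ q * (M * (B * p)) := by
      refine le_trans (le_of_eq ?_) (h8.trans (by gcongr))
      simp only [ENNReal.toReal_pow, ENNReal.toReal_inv, ENNReal.toReal_ofNat]
      rw [← pow_mul, mul_comm, pow_mul, inv_pow, ← inv_pow]
      norm_num
    have h10 : (4 : ℝ) ^ n ≤ 4 ^ ⌈2 * K⌉₊ := by
      apply pow_le_pow_right₀ (by norm_num)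
      have := Nat.le_ceil (2 * K)
      exact_mod_cast (hcase.le.trans this)
    have h6 : 1 ≤ q * (C2 * p) := by
      calc (1 : ℝ) = 4 ^ n * ((4 : ℝ) ^ n)⁻¹ := by field_simp
        _ ≤ 4 ^ ⌈2 * K⌉₊ * (q * (M * (B * p))) := by gcongr
        _ = _ := by rw [hC2]; ring
    have hqp : 0 < q := by
      rcases hq0.lt_or_eq with h | h
      · exact h
      · rw [← h] at h6; norm_num at h6
    rw [inv_le_iff_one_le_mul₀ hqp]
    have hrest : 0 ≤ q * (C1 * p) := by positivity
    have hexpand : (C1 + C2) * p * q = q * (C1 * p) + q * (C2 * p) := by ring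
    rw [hexpand]
    linarith only [h6, hrest]

/-- **Direct theorem for polynomial growth of measures** (Theorem 1.17 of Tao, "Inverse
theorems for sets and measures of polynomial growth"): if `μ` is a symmetric discrete
probability measure, `HP` a coset nilprogression of rank and nilpotency class at most `M` in
`M`-normal form, `X` a non-empty set of cardinality at most `M`, and
`∫_G ‖g‖_{HP,X}² dμ(g) ≤ M/n`, then `‖μ^{*n}‖_{ℓ²}^{-2} ≤ C_M |HP|`. -/
theorem direct_theorem_for_polynomial_growth_of_measures :
    ∀ M : ℝ, 1 ≤ M →
    ∃ C : ℝ, ∀ (G : Type u) [Group G] [DecidableEq G] (μ : G → ℝ) (Q : CosetNilprog G)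
      (X : Finset G) (n : ℕ),
      (∀ x, 0 ≤ μ x) → (∑' x, μ x) = 1 → (∀ x, μ x⁻¹ = μ x) →
      Q.IsNilprog → (Q.r : ℝ) ≤ M → (∃ s : ℕ, (s : ℝ) ≤ M ∧ Q.ClassLE s) →
      Q.InNormalForm M → X.Nonempty → (X.card : ℝ) ≤ M → 1 ≤ n →
      (∑' g : G, Q.snorm X g ^ 2 * ENNReal.ofReal (μ g)) ≤ ENNReal.ofReal (M / (n : ℝ)) →
      (∑' x, mconvPow μ n x ^ 2)⁻¹ ≤ C * (Nat.card Q.carrier : ℝ) := by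
  intro M hM
  choose C hC0 hC using fun r : ℕ => direct_fixed_rank.{u} r M hM
  refine ⟨∑ r ∈ Finset.range (⌊M⌋₊ + 1), C r, ?_⟩
  intro G _ _ μ Q X n h0 h1 hs _ hr _ hnf hX hXM hn hsum
  refine (hC Q.r G μ Q X n rfl h0 h1 hs hnf hX hXM hn hsum).trans ?_
  gcongr
  exact Finset.single_le_sum (f := C) (fun r _ => hC0 r)
    (Finset.mem_range.2 (Nat.lt_succ_of_le (Nat.le_floor hr)))
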